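/- The positive integers N satisfying σ**(σ**(N)) = 2N are exactly N = 2 and N = 9. -/

import Mathlib

def IsUnitaryDivisor (d n : ℕ) : Prop := d ∣ n ∧ Nat.gcd d (n / d) = 1

def IsBiunitaryDivisor (d n : ℕ) : Prop :=
  d ∣ n ∧ ∀ c, IsUnitaryDivisor c d → IsUnitaryDivisor c (n / d) → c = 1

open scoped Classical in
noncomputable def sbu (n : ℕ) : ℕ :=
  ∑ d ∈ n.divisors.filter (fun d => IsBiunitaryDivisor d n), d


theorem isBiunitary_iff {d n : ℕ} (hn : n ≠ 0) : IsBiunitaryDivisor d n ↔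
    d ∣ n ∧ ∀ p, p.Prime → p ∣ d → d.factorization p ≠ (n / d).factorization p := by
  unfold IsBiunitaryDivisor IsUnitaryDivisor
  refine and_congr_right fun hd => ?_
  have hd0 : d ≠ 0 := by rintro rfl; exact hn (Nat.eq_zero_of_zero_dvd hd)
  have hd1 : n / d ≠ 0 := (Nat.div_pos (Nat.le_of_dvd (Nat.pos_of_ne_zero hn) hd) (Nat.pos_of_ne_zero hd0)).ne'
  constructor
  · intro H p hp hpd heq
    have h1 : p ^ d.factorization p = 1 := by
      apply H
      · refine ⟨Nat.ordProj_dvd d p, ?_⟩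
        exact (Nat.coprime_ordCompl hp hd0).pow_left _
      · rw [heq]
        refine ⟨Nat.ordProj_dvd _ p, ?_⟩
        exact (Nat.coprime_ordCompl hp hd1).pow_left _
    have h2 : 0 < d.factorization p := hp.factorization_pos_of_dvd hd0 hpd
    have := Nat.one_lt_pow h2.ne' hp.one_lt
    omega
  · rintro H c ⟨hc1, hc2⟩ ⟨hc3, hc4⟩
    by_contra hc
    obtain ⟨p, hp, hpc⟩ := Nat.exists_prime_and_dvd hc
    apply H p hp (hpc.trans hc1)
    have key : ∀ m, m ≠ 0 → c ∣ m → Nat.gcd c (m / c) = 1 → m.factorization p = c.factorization p := by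
      intro m hm hcm hg
      have : ¬ p ∣ m / c := fun h => hp.one_lt.ne' (Nat.dvd_one.mp (hg ▸ Nat.dvd_gcd hpc h))
      have h3 := Nat.factorization_eq_zero_of_not_dvd this
      rw [Nat.factorization_div hcm] at h3
      have h4 := (Nat.factorization_le_iff_dvd (by rintro rfl; exact hm (Nat.eq_zero_of_zero_dvd hcm)) hm).mpr hcm p
      simp at h3
      omega
    rw [key d hd0 hc1 hc2, key _ hd1 hc3 hc4]

theorem sbu_mul {m n : ℕ} (hm : m ≠ 0) (hn : n ≠ 0) (h : Nat.Coprime m n) :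
    sbu (m * n) = sbu m * sbu n := by
  classical
  unfold sbu
  rw [Finset.sum_mul_sum, ← Finset.sum_product']
  symm
  have fz : ∀ {a b : ℕ}, a.Coprime b → ∀ p, p ∣ a → p.Prime → b.factorization p = 0 := by
    intro a b hab p hpa hp
    apply Nat.factorization_eq_zero_of_not_dvd
    intro hpb
    exact hp.one_lt.ne' (Nat.dvd_one.mp (hab ▸ Nat.dvd_gcd hpa hpb))
  have key : ∀ a b, a ∣ m → b ∣ n → (IsBiunitaryDivisor (a*b) (m*n) ↔ IsBiunitaryDivisor a m ∧ IsBiunitaryDivisor b n) := by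
    intro a b ha hb
    have ha0 : a ≠ 0 := by rintro rfl; exact hm (Nat.eq_zero_of_zero_dvd ha)
    have hb0 : b ≠ 0 := by rintro rfl; exact hn (Nat.eq_zero_of_zero_dvd hb)
    rw [isBiunitary_iff (mul_ne_zero hm hn), isBiunitary_iff hm, isBiunitary_iff hn]
    rw [Nat.mul_div_mul_comm ha hb]
    obtain ⟨a', rfl⟩ := ha
    obtain ⟨b', rfl⟩ := hb
    have ha'0 : a' ≠ 0 := right_ne_zero_of_mul hm
    have hb'0 : b' ≠ 0 := right_ne_zero_of_mul hn
    rw [Nat.mul_div_cancel_left _ (Nat.pos_of_ne_zero ha0), Nat.mul_div_cancel_left _ (Nat.pos_of_ne_zero hb0)]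
    rw [Nat.factorization_mul ha0 hb0, Nat.factorization_mul ha'0 hb'0]
    have d1 : a * b ∣ a * a' * (b * b') := ⟨a' * b', by ring⟩
    simp only [d1, dvd_mul_right, true_and, Finsupp.add_apply]
    have hab : a.Coprime b := h.coprime_dvd_left (dvd_mul_right _ _) |>.coprime_dvd_right (dvd_mul_right _ _)
    have hab' : a.Coprime b' := h.coprime_dvd_left (dvd_mul_right _ _) |>.coprime_dvd_right (dvd_mul_left _ _)
    have hba' : b.Coprime a' := (h.coprime_dvd_left (dvd_mul_left _ _) |>.coprime_dvd_right (dvd_mul_right _ _)).symm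
    constructor
    · intro H
      refine ⟨fun p hp hpa => ?_, fun p hp hpb => ?_⟩
      · have := H p hp (hpa.mul_right b)
        rwa [fz hab p hpa hp, fz hab' p hpa hp] at this
      · have := H p hp (hpb.mul_left a)
        rwa [fz hab.symm p hpb hp, fz hba' p hpb hp, zero_add, zero_add] at this
    · rintro ⟨H1, H2⟩ p hp hpab
      rcases (hp.dvd_mul).mp hpab with hpa | hpb
      · rw [fz hab p hpa hp, fz hab' p hpa hp]; exact H1 p hp hpa
      · rw [fz hab.symm p hpb hp, fz hba' p hpb hp, zero_add, zero_add]; exact H2 p hp hpb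
  refine Finset.sum_bij' (fun x _ => x.1 * x.2) (fun d _ => (Nat.gcd d m, Nat.gcd d n)) ?_ ?_ ?_ ?_ ?_
  · rintro ⟨a, b⟩ hx
    simp only [Finset.mem_product, Finset.mem_filter, Nat.mem_divisors] at hx ⊢
    exact ⟨⟨mul_dvd_mul hx.1.1.1 hx.2.1.1, mul_ne_zero hm hn⟩, (key a b hx.1.1.1 hx.2.1.1).mpr ⟨hx.1.2, hx.2.2⟩⟩
  · intro d hx
    simp only [Finset.mem_product, Finset.mem_filter, Nat.mem_divisors] at hx ⊢
    have e : Nat.gcd d m * Nat.gcd d n = d := by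
      rw [← Nat.Coprime.gcd_mul d h]; exact Nat.gcd_eq_left hx.1.1
    have := (key _ _ (Nat.gcd_dvd_right d m) (Nat.gcd_dvd_right d n)).mp (by rw [e]; exact hx.2)
    exact ⟨⟨⟨Nat.gcd_dvd_right d m, hm⟩, this.1⟩, ⟨⟨Nat.gcd_dvd_right d n, hn⟩, this.2⟩⟩
  · rintro ⟨a, b⟩ hx
    simp only [Finset.mem_product, Finset.mem_filter, Nat.mem_divisors] at hx ⊢
    have h1 : Nat.Coprime b m := (h.coprime_dvd_right hx.2.1.1).symm
    have h2 : Nat.Coprime a n := h.coprime_dvd_left hx.1.1.1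
    rw [Nat.Coprime.gcd_mul_right_cancel _ h1, Nat.Coprime.gcd_mul_left_cancel _ h2, Nat.gcd_eq_left hx.1.1.1, Nat.gcd_eq_left hx.2.1.1]
  · intro d hx
    simp only [Finset.mem_filter, Nat.mem_divisors] at hx ⊢
    rw [← Nat.Coprime.gcd_mul d h]; exact Nat.gcd_eq_left hx.1.1
  · rintro ⟨a, b⟩ hx
    rfl

theorem sbu_pow {p : ℕ} (hp : p.Prime) (e : ℕ) :
    sbu (p ^ e) = ∑ i ∈ (Finset.range (e+1)).filter (fun i => 2 * i ≠ e ∨ i = 0), p ^ i := by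
  classical
  unfold sbu
  rw [Nat.divisors_prime_pow hp, Finset.filter_map, Finset.sum_map]
  refine Finset.sum_congr ?_ (fun i _ => rfl)
  apply Finset.filter_congr
  intro i hi
  have hi' : i ≤ e := by simpa [Nat.lt_succ_iff] using hi
  simp only [Function.comp, Function.Embedding.coeFn_mk]
  rw [isBiunitary_iff (pow_ne_zero _ hp.ne_zero), Nat.pow_div hi' hp.pos]
  constructor
  · rintro ⟨_, H⟩
    by_cases h0 : i = 0
    · exact Or.inr h0
    · left
      have := H p hp (dvd_pow_self p h0)
      simp [hp.factorization_self] at this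
      omega
  · intro H
    refine ⟨pow_dvd_pow p hi', fun r hr hrp => ?_⟩
    have hrp' := (Nat.prime_dvd_prime_iff_eq hr hp).mp (hr.dvd_of_dvd_pow hrp)
    subst hrp'
    have : i ≠ 0 := by rintro rfl; exact hr.one_lt.ne' (Nat.dvd_one.mp (by simpa using hrp))
    simp [hr.factorization_self]
    omega

theorem sbu_one : sbu 1 = 1 := by
  have := sbu_pow Nat.prime_two 0
  rw [Finset.filter_true_of_mem (by simp)] at this
  simpa using this

theorem sbu_odd {p : ℕ} (hp : p.Prime) (j : ℕ) :
    sbu (p ^ (2*j+1)) = (∑ i ∈ Finset.range (j+1), p ^ i) * (p ^ (j+1) + 1) := by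
  rw [sbu_pow hp, Finset.filter_true_of_mem (by intro i _; left; omega)]
  rw [show 2*j+1+1 = (j+1)+(j+1) by ring, Finset.sum_range_add]
  simp only [pow_add, ← Finset.mul_sum]
  ring

theorem sbu_even {p : ℕ} (hp : p.Prime) (j : ℕ) (hj : 0 < j) :
    sbu (p ^ (2*j)) = (∑ i ∈ Finset.range j, p ^ i) * (p ^ (j+1) + 1) := by
  have : (Finset.range (2*j+1)).filter (fun i => 2 * i ≠ 2*j ∨ i = 0) = (Finset.range (2*j+1)).erase j := by
    ext i; simp only [Finset.mem_filter, Finset.mem_erase, Finset.mem_range]; omega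
  rw [sbu_pow hp, this]
  have h1 := Finset.add_sum_erase (Finset.range (2*j+1)) (fun i => p^i) (a := j) (by simp; omega)
  rw [show 2*j+1 = (j+1) + j by ring, Finset.sum_range_add, Finset.sum_range_succ] at h1
  simp only [pow_add, ← Finset.mul_sum] at h1
  rw [show 2*j+1 = (j+1) + j by ring]
  simp only [pow_add]
  linarith

theorem sbu_ge_of_subset {p : ℕ} (hp : p.Prime) (e : ℕ) (s : Finset ℕ)
    (h : ∀ i ∈ s, i ≤ e ∧ (2 * i ≠ e ∨ i = 0)) : ∑ i ∈ s, p ^ i ≤ sbu (p ^ e) := by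
  rw [sbu_pow hp]
  apply Finset.sum_le_sum_of_subset
  intro i hi
  have := h i hi
  simp only [Finset.mem_filter, Finset.mem_range]
  exact ⟨by omega, this.2⟩

theorem sbu_pow_ge {p : ℕ} (hp : p.Prime) {e : ℕ} (he : 0 < e) : p ^ e + 1 ≤ sbu (p ^ e) := by
  have := sbu_ge_of_subset hp e {e, 0} (by simp; omega)
  rwa [Finset.sum_pair (by omega), pow_zero] at this

theorem sbu_pow_ge2 {p : ℕ} (hp : p.Prime) {e : ℕ} (he : 0 < e) (h2 : e ≠ 2) :
    p ^ e + p ^ (e-1) ≤ sbu (p ^ e) := by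
  have := sbu_ge_of_subset hp e {e, e-1} (by simp; omega)
  rwa [Finset.sum_pair (by omega)] at this

theorem sbu_pow_ge3 {p : ℕ} (hp : p.Prime) {e : ℕ} (he : e = 3 ∨ 5 ≤ e) :
    p ^ e + p ^ (e-1) + p ^ (e-2) ≤ sbu (p ^ e) := by
  have := sbu_ge_of_subset hp e {e, e-1, e-2} (by simp; omega)
  rwa [Finset.sum_insert (by simp; omega), Finset.sum_pair (by omega), ← add_assoc] at this

theorem sbu_pow_lt {p : ℕ} (hp : p.Prime) (e : ℕ) : (p - 1) * sbu (p ^ e) < p ^ (e+1) := by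
  have h1 : sbu (p^e) ≤ ∑ i ∈ Finset.range (e+1), p ^ i := by
    rw [sbu_pow hp]
    exact Finset.sum_le_sum_of_subset (Finset.filter_subset _ _)
  have h2 := Nat.geomSum_eq hp.two_le (e+1)
  have h3 : (p-1) * (∑ i ∈ Finset.range (e+1), p ^ i) ≤ p^(e+1) - 1 := by
    rw [h2]; exact Nat.mul_div_le _ _
  have : 0 < p^(e+1) := pow_pos hp.pos _
  have := Nat.mul_le_mul_left (p-1) h1
  omega

theorem sbu_split {p n : ℕ} (hp : p.Prime) (hn : n ≠ 0) (h : p ∣ n) :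
    ∃ e m, 0 < e ∧ n = p ^ e * m ∧ ¬ p ∣ m ∧ m ≠ 0 ∧ sbu n = sbu (p ^ e) * sbu m := by
  refine ⟨n.factorization p, n / p ^ n.factorization p, hp.factorization_pos_of_dvd hn h,
    (Nat.ordProj_mul_ordCompl_eq_self n p).symm, Nat.not_dvd_ordCompl hp hn, (Nat.ordCompl_pos p hn).ne', ?_⟩
  rw [← sbu_mul (pow_ne_zero _ hp.ne_zero) (Nat.ordCompl_pos p hn).ne' ((Nat.coprime_ordCompl hp hn).pow_left _),
    Nat.ordProj_mul_ordCompl_eq_self]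

theorem sbu_mul_pow {p m : ℕ} (hp : p.Prime) (e : ℕ) (hm : m ≠ 0) (h : ¬ p ∣ m) :
    sbu (p ^ e * m) = sbu (p ^ e) * sbu m :=
  sbu_mul (pow_ne_zero _ hp.ne_zero) hm (((Nat.Prime.coprime_iff_not_dvd hp).mpr h).pow_left _)

theorem le_sbu {n : ℕ} (hn : n ≠ 0) : n ≤ sbu n := by
  unfold sbu
  apply Finset.single_le_sum (f := fun d => d) (fun _ _ => Nat.zero_le _)
  simp only [Finset.mem_filter, Nat.mem_divisors, dvd_refl, true_and, hn, ne_eq, not_false_eq_true]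
  refine ⟨dvd_refl _, fun c _ hc => ?_⟩
  rw [Nat.div_self (Nat.pos_of_ne_zero hn)] at hc
  exact Nat.dvd_one.mp hc.1

theorem sbu_ne_zero {n : ℕ} (hn : n ≠ 0) : sbu n ≠ 0 := by
  have := le_sbu hn; omega

noncomputable def hh (n : ℕ) : ℚ := sbu n / n

theorem one_le_hh {n : ℕ} (hn : n ≠ 0) : 1 ≤ hh n := by
  have h0 : (0:ℚ) < n := by positivity
  unfold hh; rw [le_div_iff₀ h0, one_mul]; exact_mod_cast le_sbu hn

theorem hh_mul {p m : ℕ} (hp : p.Prime) (e : ℕ) (hm : m ≠ 0) (h : ¬ p ∣ m) :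
    hh (p ^ e * m) = hh (p ^ e) * hh m := by
  unfold hh; rw [sbu_mul_pow hp e hm h]; push_cast; rw [mul_div_mul_comm]

theorem hh_ge {p : ℕ} (hp : p.Prime) {e : ℕ} (he : 0 < e) (h2 : e ≠ 2) : 1 + 1 / (p:ℚ) ≤ hh (p ^ e) := by
  have hp0 : (0:ℚ) < p := by exact_mod_cast hp.pos
  unfold hh
  have := sbu_pow_ge2 hp he h2
  obtain ⟨k, rfl⟩ : ∃ k, e = k + 1 := ⟨e-1, by omega⟩
  have h3 : (p:ℚ)^(k+1) + p^k ≤ sbu (p^(k+1)) := by exact_mod_cast this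
  push_cast
  rw [le_div_iff₀ (by positivity)]
  refine le_trans (le_of_eq ?_) h3
  field_simp
  ring

theorem hh_ge3 {p : ℕ} (hp : p.Prime) {e : ℕ} (he : e = 3 ∨ 5 ≤ e) : 1 + 1 / (p:ℚ) + 1 / (p:ℚ)^2 ≤ hh (p ^ e) := by
  have hp0 : (0:ℚ) < p := by exact_mod_cast hp.pos
  unfold hh
  have := sbu_pow_ge3 hp he
  obtain ⟨k, rfl⟩ : ∃ k, e = k + 2 := ⟨e-2, by omega⟩
  have h3 : (p:ℚ)^(k+2) + p^(k+1) + p^k ≤ sbu (p^(k+2)) := by exact_mod_cast this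
  push_cast
  rw [le_div_iff₀ (by positivity)]
  refine le_trans (le_of_eq ?_) h3
  field_simp
  ring

theorem sbu_sq {p : ℕ} (hp : p.Prime) : sbu (p ^ 2) = p ^ 2 + 1 := by
  have := sbu_even hp 1 one_pos
  simpa using this

theorem sbu_prime {p : ℕ} (hp : p.Prime) : sbu (p ^ 1) = p + 1 := by
  have := sbu_odd hp 0
  simpa using this

theorem hh_sq {p : ℕ} (hp : p.Prime) : hh (p ^ 2) = 1 + 1 / (p:ℚ)^2 := by
  have hp0 : (0:ℚ) < p := by exact_mod_cast hp.pos
  unfold hh; rw [sbu_sq hp]; push_cast; field_simp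

theorem hh_prime {p : ℕ} (hp : p.Prime) : hh (p ^ 1) = 1 + 1 / (p:ℚ) := by
  have hp0 : (0:ℚ) < p := by exact_mod_cast hp.pos
  unfold hh; rw [sbu_prime hp]; push_cast; field_simp

theorem hh_ge1 {p : ℕ} (hp : p.Prime) {e : ℕ} (he : 0 < e) : 1 + 1 / (p:ℚ)^2 ≤ hh (p ^ e) := by
  by_cases h2 : e = 2
  · subst h2; rw [hh_sq hp]
  · refine le_trans ?_ (hh_ge hp he h2)
    have hp0 : (1:ℚ) ≤ p := by exact_mod_cast hp.one_le
    gcongr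
    nlinarith

theorem hh_lt {p : ℕ} (hp : p.Prime) (e : ℕ) : hh (p ^ e) * (p - 1) < p := by
  have hp0 : (0:ℚ) < p := by exact_mod_cast hp.pos
  have := sbu_pow_lt hp e
  have h3 : ((p:ℚ)-1) * sbu (p^e) < p^(e+1) := by
    have h4 : (((p - 1 : ℕ) : ℚ)) * sbu (p^e) < p^(e+1) := by exact_mod_cast this
    rwa [Nat.cast_sub hp.one_le, Nat.cast_one] at h4
  unfold hh
  push_cast
  rw [div_mul_eq_mul_div, div_lt_iff₀ (by positivity)]
  rw [pow_succ] at h3; linarith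
  
theorem hh_dvd {p n : ℕ} (hp : p.Prime) (hn : n ≠ 0) (h : p ∣ n) : 1 + 1 / (p:ℚ)^2 ≤ hh n := by
  obtain ⟨e, m, he, rfl, hpm, hm, -⟩ := sbu_split hp hn h
  rw [hh_mul hp e hm hpm]
  have h1 := hh_ge1 hp he
  have h2 := one_le_hh hm
  have h3 : 0 ≤ hh (p ^ e) := by unfold hh; positivity
  exact h1.trans (le_mul_of_one_le_right h3 h2)

theorem odd_geom {p : ℕ} (hp : p % 2 = 1) (j : ℕ) : (∑ i ∈ Finset.range j, p ^ i) % 2 = j % 2 := by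
  induction j with
  | zero => simp
  | succ k ih =>
    rw [Finset.sum_range_succ, Nat.add_mod, ih, Nat.pow_mod, hp]; simp

theorem geom_int (p j : ℕ) : ((∑ i ∈ Finset.range j, p ^ i : ℕ) : ℤ) * (p - 1) = p ^ j - 1 := by
  push_cast; exact geom_sum_mul _ _

theorem geom_gt {p j : ℕ} (hp : 0 < p) (hj : 2 ≤ j) : 1 < ∑ i ∈ Finset.range j, p ^ i := by
  obtain ⟨k, rfl⟩ : ∃ k, j = 2 + k := ⟨j-2, by omega⟩
  rw [Finset.sum_range_add, Finset.sum_range_succ, Finset.sum_range_one, pow_zero]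
  have : 0 < p^1 := by positivity
  omega

theorem odd_of_ne_two {p : ℕ} (hp : p.Prime) (h2 : p ≠ 2) : p % 2 = 1 := by
  rcases hp.eq_two_or_odd with h | h
  · exact absurd h h2
  · exact h

theorem pow_odd_mod {p : ℕ} (hp : p % 2 = 1) (j : ℕ) : p ^ j % 2 = 1 := by
  rw [Nat.pow_mod, hp]; simp

theorem exp_cases {e : ℕ} (he : 0 < e) : (∃ j, e = 2*j+1) ∨ ∃ j, 0 < j ∧ e = 2*j := by
  rcases Nat.even_or_odd' e with ⟨j, h | h⟩
  · right; exact ⟨j, by omega, h⟩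
  · left; exact ⟨j, h⟩

theorem two_dvd_sbu {p e : ℕ} (hp : p.Prime) (h2 : p ≠ 2) (he : 0 < e) : 2 ∣ sbu (p ^ e) := by
  have ho := odd_of_ne_two hp h2
  rcases exp_cases he with ⟨j, rfl⟩ | ⟨j, hj, rfl⟩
  · rw [sbu_odd hp]
    have := pow_odd_mod ho (j+1)
    exact Dvd.dvd.mul_left (by omega) _
  · rw [sbu_even hp j hj]
    have := pow_odd_mod ho (j+1)
    exact Dvd.dvd.mul_left (by omega) _

theorem geom_two (j : ℕ) : ∑ i ∈ Finset.range j, 2 ^ i = 2 ^ j - 1 := by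
  have := Nat.geomSum_eq (le_refl 2) j
  simpa using this

theorem sbu_two_odd (j : ℕ) : sbu (2 ^ (2*j+1)) = (2^(j+1)-1) * (2^(j+1)+1) := by
  rw [sbu_odd Nat.prime_two, geom_two]

theorem sbu_two_even (j : ℕ) (hj : 0 < j) : sbu (2 ^ (2*j)) = (2^j-1) * (2^(j+1)+1) := by
  rw [sbu_even Nat.prime_two j hj, geom_two]

theorem sbu_two_mod (e : ℕ) : sbu (2 ^ e) % 2 = 1 := by
  rcases Nat.eq_zero_or_pos e with rfl | he
  · simp [sbu_one]
  have h : ∀ k, 0 < k → 2 ^ k % 2 = 0 := by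
    intro k hk; obtain ⟨l, rfl⟩ : ∃ l, k = l+1 := ⟨k-1, by omega⟩
    rw [pow_succ]; omega
  rcases exp_cases he with ⟨j, rfl⟩ | ⟨j, hj, rfl⟩
  · rw [sbu_two_odd, Nat.mul_mod]
    have := h (j+1) (by omega)
    have h3 : 0 < 2^(j+1) := by positivity
    rw [show (2^(j+1)-1) % 2 = 1 by omega, show (2^(j+1)+1) % 2 = 1 by omega]
  · rw [sbu_two_even j hj, Nat.mul_mod]
    have := h (j+1) (by omega)
    have := h j hj
    have h3 : 0 < 2^j := by positivity
    rw [show (2^j-1) % 2 = 1 by omega, show (2^(j+1)+1) % 2 = 1 by omega]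

theorem helper {A B q b : ℕ} (hq : q.Prime) (hq2 : q ≠ 2) (h : A * B = 2 * q ^ b) (hB : 2 ∣ B) :
    A % 2 = 1 ∧ (A ≠ 1 → q ∣ A) ∧ (B ≠ 2 → q ∣ B) := by
  obtain ⟨B', rfl⟩ := hB
  have h' : A * B' = q ^ b := by
    have : 2 * (A * B') = 2 * q^b := by rw [← h]; ring
    omega
  have ho : q ^ b % 2 = 1 := pow_odd_mod (odd_of_ne_two hq hq2) b
  have key : ∀ C, C ∣ q ^ b → C ≠ 1 → q ∣ C := by
    intro C hC h1
    obtain ⟨i, _, rfl⟩ := (Nat.dvd_prime_pow hq).mp hC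
    exact dvd_pow_self _ (by rintro rfl; simp at h1)
  refine ⟨?_, fun h1 => key A ⟨_, h'.symm⟩ h1, fun h1 => (key B' ⟨A, by rw [← h']; ring⟩ (by omega)).mul_left 2⟩
  by_contra hA
  have hA0 : 2 ∣ A := by omega
  have : 2 ∣ q ^ b := h' ▸ hA0.mul_right B'
  omega

theorem lemL {p q e b : ℕ} (hp : p.Prime) (h2 : p ≠ 2) (hq : q.Prime) (hq2 : q ≠ 2) (he : 0 < e)
    (h : sbu (p ^ e) = 2 * q ^ b) : e = 1 ∨ e = 2 := by
  have ho := odd_of_ne_two hp h2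
  have hp3 : 3 ≤ p := by have := hp.two_le; omega
  have nodvd2 : ¬ ((q:ℤ) ∣ 2) := by
    intro hd
    have : q ∣ 2 := by exact_mod_cast hd
    exact hq2 ((Nat.prime_dvd_prime_iff_eq hq Nat.prime_two).mp this)
  rcases exp_cases he with ⟨j, rfl⟩ | ⟨j, hj, rfl⟩
  · rw [sbu_odd hp] at h
    have hm := pow_odd_mod ho (j+1)
    obtain ⟨h1, hA, hB⟩ := helper hq hq2 h (by omega)
    by_contra hcon
    have hj : 1 ≤ j := by omega
    have hA' := hA (geom_gt hp.pos (by omega)).ne'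
    have hgt : p ≤ p ^ (j+1) := le_trans (pow_one p).ge (Nat.pow_le_pow_right hp.pos (by omega))
    have hB' := hB (by omega)
    have hA2 : (q:ℤ) ∣ p^(j+1) - 1 := by
      rw [← geom_int]; exact Dvd.dvd.mul_right (by exact_mod_cast hA') _
    have hB2 : (q:ℤ) ∣ p^(j+1) + 1 := by exact_mod_cast hB'
    apply nodvd2
    have := dvd_sub hB2 hA2
    ring_nf at this; exact this
  · rw [sbu_even hp j hj] at h
    have hm := pow_odd_mod ho (j+1)
    obtain ⟨h1, hA, hB⟩ := helper hq hq2 h (by omega)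
    rw [odd_geom ho] at h1
    by_contra hcon
    have hA' := hA (geom_gt hp.pos (by omega)).ne'
    have hgt : p ≤ p ^ (j+1) := le_trans (pow_one p).ge (Nat.pow_le_pow_right hp.pos (by omega))
    have hB' := hB (by omega)
    have hA2 : (q:ℤ) ∣ p^j - 1 := by
      rw [← geom_int]; exact Dvd.dvd.mul_right (by exact_mod_cast hA') _
    have hB2 : (q:ℤ) ∣ p^(j+1) + 1 := by exact_mod_cast hB'
    have hC : (q:ℤ) ∣ p + 1 := by
      have := dvd_sub hB2 (hA2.mul_left (p:ℤ))
      ring_nf at this; rw [add_comm] at this; exact this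
    have hD : (q:ℤ) ∣ p^j + 1 := by
      refine hC.trans ?_
      have := Odd.add_dvd_pow_add_pow (p:ℤ) 1 (n := j) (Nat.odd_iff.mpr h1)
      simpa using this
    apply nodvd2
    have := dvd_sub hD hA2
    ring_nf at this; exact this

theorem sq_mod4 {x : ℕ} (h : x % 2 = 1) : (x^2 + 1) % 4 = 2 := by
  have : x % 4 = 1 ∨ x % 4 = 3 := by omega
  rcases this with h | h <;> simp [Nat.add_mod, Nat.pow_mod, h]

theorem pow2_aux {x c : ℕ} (h : x ∣ 2 ^ c) (h4 : x % 4 = 2) : x = 2 := by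
  obtain ⟨i, _, rfl⟩ := (Nat.dvd_prime_pow Nat.prime_two).mp h
  match i with
  | 0 => simp at h4
  | 1 => rfl
  | k+2 => rw [pow_add] at h4; omega

theorem pow2_dvd {x y c : ℕ} (hx : x ∣ 2 ^ c) (hy : y ∣ 2 ^ c) (h : x < y) : 2 * x ∣ y := by
  obtain ⟨i, _, rfl⟩ := (Nat.dvd_prime_pow Nat.prime_two).mp hx
  obtain ⟨j, _, rfl⟩ := (Nat.dvd_prime_pow Nat.prime_two).mp hy
  have : i < j := (Nat.pow_lt_pow_iff_right (by norm_num)).mp h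
  rw [← pow_succ']; exact pow_dvd_pow _ this

theorem lemPow2 {p e c : ℕ} (hp : p.Prime) (h2 : p ≠ 2) (he : 0 < e)
    (h : sbu (p ^ e) ∣ 2 ^ c) : e = 1 := by
  have ho := odd_of_ne_two hp h2
  have hp3 : 3 ≤ p := by have := hp.two_le; omega
  have even_contra : ∀ i, 0 < i → p ^ (2*i) + 1 ∣ 2 ^ c → False := by
    intro i hi hd
    have h5 := sq_mod4 (pow_odd_mod ho i)
    rw [← pow_mul, mul_comm] at h5
    have := pow2_aux hd h5
    have hgt : p ≤ p ^ (2*i) := le_trans (pow_one p).ge (Nat.pow_le_pow_right hp.pos (by omega))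
    omega
  rcases exp_cases he with ⟨j, rfl⟩ | ⟨j, hj, rfl⟩
  · rw [sbu_odd hp] at h
    by_contra hcon
    have hA := (dvd_mul_right _ _).trans h
    have hB := (dvd_mul_left _ _).trans h
    have h1 := pow2_dvd (one_dvd _) hA (geom_gt hp.pos (by omega))
    have h3 := odd_geom ho (j+1)
    obtain ⟨i, hi⟩ : ∃ i, j + 1 = 2*i := ⟨(j+1)/2, by omega⟩
    rw [hi] at hB
    exact even_contra i (by omega) hB
  · rw [sbu_even hp j hj] at h
    exfalso
    have hA := (dvd_mul_right _ _).trans h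
    have hB := (dvd_mul_left _ _).trans h
    rcases Nat.even_or_odd' j with ⟨i, hi | hi⟩
    · have hgt : p ^ 2 ≤ p ^ (j+1) := Nat.pow_le_pow_right hp.pos (by omega)
      have hd : p + 1 ∣ p^(j+1) + 1 := by
        have := Odd.nat_add_dvd_pow_add_pow p 1 (n := j+1) ⟨i, by omega⟩
        simpa using this
      have h6 := pow2_dvd (hd.trans hB) hB (by nlinarith)
      have h7 : (2 * ((p:ℤ) + 1)) ∣ p^(j+1) + 1 := by exact_mod_cast h6
      have h8 : (2 * ((p:ℤ) + 1)) ∣ p^2 - 1 := by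
        have : (2:ℤ) ∣ p - 1 := by omega
        have := mul_dvd_mul this (dvd_refl ((p:ℤ)+1))
        rwa [show ((p:ℤ) - 1) * (p + 1) = p^2 - 1 by ring] at this
      have h9 : (2 * ((p:ℤ) + 1)) ∣ p^j - 1 := by
        refine h8.trans ?_
        have := sub_dvd_pow_sub_pow ((p:ℤ)^2) 1 i
        rwa [one_pow, ← pow_mul, ← hi] at this
      have h10 := dvd_sub h7 (h9.mul_left (p:ℤ))
      have h11 : (2 * ((p:ℤ) + 1)) ∣ p + 1 := by
        rwa [show (p:ℤ)^(j+1) + 1 - p * (p^j - 1) = p + 1 by ring] at h10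
      have := Int.le_of_dvd (by positivity) h11
      omega
    · rw [show j + 1 = 2*(i+1) by omega] at hB
      exact even_contra (i+1) (by omega) hB

theorem not4 {n : ℕ} (hn : n % 2 = 1) (h : ¬ 4 ∣ sbu n) :
    n = 1 ∨ ∃ q g, q.Prime ∧ q ≠ 2 ∧ 0 < g ∧ n = q ^ g := by
  by_cases h1 : n = 1
  · exact Or.inl h1
  right
  obtain ⟨p, hp, hpn⟩ := Nat.exists_prime_and_dvd h1
  have hp2 : p ≠ 2 := by rintro rfl; omega
  obtain ⟨e, m, he, hnm, hpm, hm, hs⟩ := sbu_split hp (by omega) hpn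
  refine ⟨p, e, hp, hp2, he, ?_⟩
  by_cases hm1 : m = 1
  · rw [hnm, hm1, mul_one]
  exfalso
  obtain ⟨r, hr, hrm⟩ := Nat.exists_prime_and_dvd hm1
  have hr2 : r ≠ 2 := by
    rintro rfl
    have : 2 ∣ n := by rw [hnm]; exact hrm.mul_left _
    omega
  obtain ⟨f, k, hf, hmk, hrk, hk, hs2⟩ := sbu_split hr hm hrm
  apply h
  rw [hs, hs2]
  exact mul_dvd_mul (two_dvd_sbu hp hp2 he) ((two_dvd_sbu hr hr2 hf).mul_right _)

theorem not_dvd_sbu {p e : ℕ} (hp : p.Prime) : ¬ p ∣ sbu (p ^ e) := by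
  have h1 : ∀ k x, 0 < k → p ∣ x * (p^k + 1) → p ∣ x := by
    intro k x hk h
    rcases (hp.dvd_mul).mp h with h | h
    · exact h
    · have := (Nat.dvd_add_right (dvd_pow_self p hk.ne')).mp h
      exact absurd (Nat.dvd_one.mp this) hp.one_lt.ne'
  have h2 : ∀ j, 0 < j → ¬ p ∣ ∑ i ∈ Finset.range j, p ^ i := by
    intro j hj h
    obtain ⟨k, rfl⟩ : ∃ k, j = k+1 := ⟨j-1, by omega⟩
    rw [Finset.sum_range_succ', pow_zero] at h
    have h3 : p ∣ ∑ i ∈ Finset.range k, p^(i+1) := Finset.dvd_sum fun i _ => dvd_pow_self p (by omega)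
    have := (Nat.dvd_add_right h3).mp h
    exact absurd (Nat.dvd_one.mp this) hp.one_lt.ne'
  rcases Nat.eq_zero_or_pos e with rfl | he
  · simp [sbu_one, hp.one_lt.ne']
  rcases exp_cases he with ⟨j, rfl⟩ | ⟨j, hj, rfl⟩
  · rw [sbu_odd hp]; exact fun h => h2 _ (by omega) (h1 _ _ (by omega) h)
  · rw [sbu_even hp j hj]; exact fun h => h2 _ (by omega) (h1 _ _ (by omega) h)

theorem hh_eq {N : ℕ} (hN : N ≠ 0) (h : sbu (sbu N) = 2 * N) : hh N * hh (sbu N) = 2 := by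
  have h1 : (N:ℚ) ≠ 0 := by exact_mod_cast hN
  have h2 : (sbu N:ℚ) ≠ 0 := by exact_mod_cast sbu_ne_zero hN
  unfold hh; rw [h]; push_cast; field_simp

theorem hh_nonneg (n : ℕ) : 0 ≤ hh n := by unfold hh; positivity

theorem mersenne_aux (c : ℕ) (hc : 3 ≤ c) : ∀ t, ¬ (2^c - 1 ∣ 2^t + 1) := by
  intro t
  induction t using Nat.strong_induction_on with
  | _ t ih =>
    intro h
    obtain ⟨c', rfl⟩ : ∃ c', c = c' + 3 := ⟨c-3, by omega⟩
    have h1 : 0 < 2^c' := by positivity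
    rcases lt_or_ge t (c'+3) with ht | ht
    · have h2 : 2^t ≤ 2^(c'+2) := Nat.pow_le_pow_right (by norm_num) (by omega)
      have h3 := Nat.le_of_dvd (by positivity) h
      rw [pow_add] at h2 h3
      omega
    · obtain ⟨s, rfl⟩ : ∃ s, t = s + (c'+3) := ⟨t-(c'+3), by omega⟩
      apply ih s (by omega)
      have h4 : 2^(s+(c'+3)) + 1 = (2^(c'+3)-1) * 2^s + (2^s+1) := by
        have : 1 ≤ 2^(c'+3) := Nat.one_le_two_pow
        obtain ⟨y, hy⟩ : ∃ y, 2^(c'+3) = y + 1 := ⟨2^(c'+3)-1, by omega⟩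
        rw [pow_add, hy]; simp; ring
      rw [h4] at h
      exact (Nat.dvd_add_right (dvd_mul_right _ _)).mp h

theorem caseModd {N : ℕ} (hN : N ≠ 0) (hN1 : N ≠ 1) (hM : sbu N % 2 = 1) (h : sbu (sbu N) = 2 * N) :
    N = 2 := by
  have hpow : N = 2 ^ N.primeFactorsList.length := by
    apply Nat.eq_prime_pow_of_unique_prime_dvd hN
    intro p hp hpN
    by_contra h2
    obtain ⟨e, m, he, -, -, -, hs⟩ := sbu_split hp hN hpN
    have : 2 ∣ sbu N := by rw [hs]; exact (two_dvd_sbu hp h2 he).mul_right _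
    omega
  generalize N.primeFactorsList.length = e at hpow
  have he : 0 < e := by
    rcases Nat.eq_zero_or_pos e with rfl | h
    · exact absurd hpow hN1
    · exact h
  have hM0 := sbu_ne_zero hN
  have hprime : ∀ p, p.Prime → p ∣ sbu N → ¬ p^2 ∣ sbu N ∧ ∃ c, p + 1 = 2^c := by
    intro p hp hpM
    have hp2 : p ≠ 2 := by rintro rfl; omega
    obtain ⟨a, m, ha, hMm, hpm, hm, hs⟩ := sbu_split hp hM0 hpM
    have hd : sbu (p^a) ∣ 2^(e+1) := ⟨sbu m, by rw [← hs, h, hpow]; ring⟩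
    have ha1 := lemPow2 hp hp2 ha hd
    subst ha1
    refine ⟨?_, ?_⟩
    · intro h3
      rw [hMm, pow_one, pow_two] at h3
      exact hpm (Nat.dvd_of_mul_dvd_mul_left hp.pos h3)
    · rw [sbu_prime hp] at hd
      obtain ⟨c, _, hc⟩ := (Nat.dvd_prime_pow Nat.prime_two).mp hd
      exact ⟨c, hc⟩
  have key : ∀ t, 0 < t → 2^t + 1 ∣ sbu N → t = 1 := by
    intro t ht hd
    have h3 : ∀ p, p.Prime → p ∣ 2^t+1 → p = 3 := by
      intro p hp hpt
      obtain ⟨-, c, hc⟩ := hprime p hp (hpt.trans hd)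
      rcases lt_or_ge c 3 with hc3 | hc3
      · have hp2 : p ≠ 2 := by rintro rfl; have := hpt.trans hd; omega
        have := hp.two_le
        interval_cases c <;> omega
      · exact absurd (by rwa [show p = 2^c - 1 by omega] at hpt) (mersenne_aux c hc3 t)
    have h1 : 2^t + 1 ≠ 1 := by have : 0 < 2^t := by positivity
                                omega
    obtain ⟨p, hp, hpt⟩ := Nat.exists_prime_and_dvd h1
    have hp3 := h3 p hp hpt
    subst hp3
    obtain ⟨D, hD⟩ := hpt
    by_cases hD1 : D = 1
    · rw [hD1] at hD
      have : 2^t = 2^1 := by omega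
      exact Nat.pow_right_injective (le_refl 2) this
    · exfalso
      obtain ⟨r, hr, hrD⟩ := Nat.exists_prime_and_dvd hD1
      have hr3 := h3 r hr (by rw [hD]; exact hrD.mul_left _)
      subst hr3
      apply (hprime 3 hr (Dvd.dvd.trans (by rw [hD]; exact dvd_mul_right _ _) hd)).1
      refine Dvd.dvd.trans ?_ hd
      rw [hD, pow_two]; exact mul_dvd_mul_left _ hrD
  rcases exp_cases he with ⟨j, rfl⟩ | ⟨j, hj, rfl⟩
  · have := key (j+1) (by omega) (by rw [hpow, sbu_two_odd]; exact dvd_mul_left _ _)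
    have : j = 0 := by omega
    subst this
    simpa using hpow
  · have := key (j+1) (by omega) (by rw [hpow, sbu_two_even j hj]; exact dvd_mul_left _ _)
    omega

theorem not_dvd_of_odd {n : ℕ} (h : n % 2 = 1) : ¬ 2 ∣ n := by omega

theorem sub25 {n m : ℕ} (hn : n ≠ 0) (hm : m ≠ 0) (h : hh n * hh m = 32/25) (h5 : 5 ∣ n) (h5' : 5 ∣ m)
    (h3 : 3 ∣ sbu n → 3 ∣ m) : ∃ n', n = 5^2 * n' ∧ ¬ 5 ∣ n' ∧ n' ≠ 0 := by
  have p5 : Nat.Prime 5 := by norm_num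
  have p3 : Nat.Prime 3 := by norm_num
  obtain ⟨a, n', ha, hnn, hpn, hn', hs⟩ := sbu_split p5 hn h5
  by_cases ha2 : a = 2
  · exact ⟨n', by rw [hnn, ha2], hpn, hn'⟩
  exfalso
  rw [hnn, hh_mul p5 a hn' hpn] at h
  have h1 := one_le_hh hn'
  by_cases ha3 : a = 3 ∨ 5 ≤ a
  · have h2 := hh_ge3 p5 ha3
    have h4 := hh_dvd p5 hm h5'
    norm_num at h2 h4
    have h6 : hh (5^a) ≤ hh (5^a) * hh n' := le_mul_of_one_le_right (hh_nonneg _) h1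
    nlinarith
  · have hd : 3 ∣ sbu n := by
      rw [hs]
      apply Dvd.dvd.mul_right
      have : a = 1 ∨ a = 4 := by omega
      rcases this with rfl | rfl
      · rw [sbu_prime p5]; decide
      · rw [sbu_even p5 2 (by norm_num)]; decide
    have h4 := hh_dvd p3 hm (h3 hd)
    have h2 := hh_ge p5 ha ha2
    norm_num at h2 h4
    have h6 : hh (5^a) ≤ hh (5^a) * hh n' := le_mul_of_one_le_right (hh_nonneg _) h1
    nlinarith

theorem even22 {n m : ℕ} (hn : n % 2 = 1) (hm : m % 2 = 1) (h1 : 5 * sbu n = 4 * m)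
    (h2 : 5 * sbu m = 8 * n) : False := by
  have hn0 : n ≠ 0 := by omega
  have hm0 : m ≠ 0 := by omega
  have hh' : hh n * hh m = 32/25 := by
    have e1 : (n:ℚ) ≠ 0 := by exact_mod_cast hn0
    have e2 : (m:ℚ) ≠ 0 := by exact_mod_cast hm0
    have e3 : 5 * (sbu n : ℚ) = 4 * m := by exact_mod_cast h1
    have e4 : 5 * (sbu m : ℚ) = 8 * n := by exact_mod_cast h2
    unfold hh
    field_simp
    nlinarith
  have h5n : 5 ∣ n := by omega
  have h5m : 5 ∣ m := by omega
  obtain ⟨n', rfl, hn5, hn'⟩ := sub25 hn0 hm0 hh' h5n h5m (by omega)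
  obtain ⟨m', rfl, hm5, hm'⟩ := sub25 hm0 hn0 (by rw [mul_comm]; exact hh') h5m h5n (by omega)
  have p5 : Nat.Prime 5 := by norm_num
  have p13 : Nat.Prime 13 := by norm_num
  rw [sbu_mul_pow p5 2 hn' hn5, sbu_sq p5] at h1
  rw [sbu_mul_pow p5 2 hm' hm5, sbu_sq p5] at h2
  have h13 : 13 ∣ n' := by omega
  have h13' : 13 ∣ m' := by omega
  rcases not4 (n := n') (by omega) (by omega) with h | ⟨q, g, hq, hq2, hg, hqg⟩
  · omega
  have hq13 : 13 = q := (Nat.prime_dvd_prime_iff_eq p13 hq).mp (p13.dvd_of_dvd_pow (hqg ▸ h13))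
  subst hq13
  have hnd := not_dvd_sbu p13 (e := g)
  rw [← hqg] at hnd
  obtain ⟨m'', rfl⟩ := h13'
  have hm13 : ¬ 13 ∣ m'' := by omega
  have hs := sbu_mul_pow p13 1 (m := m'') (by omega) hm13
  rw [sbu_prime p13, pow_one] at hs
  rw [hs] at h2
  have h7' : 7 * (13 * sbu m'') = 10 * n' := by linarith
  have h7 : 7 ∣ n' := Nat.Coprime.dvd_of_dvd_mul_left (by norm_num : Nat.Coprime 7 10) ⟨_, h7'.symm⟩
  rw [hqg] at h7
  have := (Nat.prime_dvd_prime_iff_eq (by norm_num) p13).mp (Nat.Prime.dvd_of_dvd_pow (by norm_num : Nat.Prime 7) h7)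
  omega

theorem hh_two_ge {e : ℕ} (he : 3 ≤ e) : 27/16 ≤ hh (2^e) := by
  by_cases h : e = 3 ∨ 5 ≤ e
  · have := hh_ge3 Nat.prime_two h
    norm_num at this ⊢
    linarith
  · have : e = 4 := by omega
    subst this
    unfold hh
    rw [sbu_two_even 2 (by norm_num)]; norm_num

theorem caseEven {N : ℕ} (hN : N ≠ 0) (hN2 : 2 ∣ N) (hM : 2 ∣ sbu N) (h : sbu (sbu N) = 2 * N) : False := by
  have hq := hh_eq hN h
  have hM0 := sbu_ne_zero hN
  obtain ⟨e, n, he, hNn, hn2, hn, hs⟩ := sbu_split Nat.prime_two hN hN2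
  obtain ⟨f, m, hf, hMm, hm2, hm, hs'⟩ := sbu_split Nat.prime_two hM0 hM
  have p3 : Nat.Prime 3 := by norm_num
  have p5 : Nat.Prime 5 := by norm_num
  have q1 := one_le_hh hn
  have q2 := one_le_hh hm
  have E : hh (2^e) * hh n * (hh (2^f) * hh m) = 2 := by
    rw [← hh_mul Nat.prime_two e hn hn2, ← hh_mul Nat.prime_two f hm hm2, ← hNn, ← hMm, hq]
  have hle : ∀ a b c d : ℚ, 0 ≤ a → 0 ≤ b → a ≤ hh (2^e) → b ≤ hh (2^f) → 1 ≤ c → 1 ≤ d → c ≤ hh n → d ≤ hh m →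
      a * c * (b * d) ≤ 2 := by
    intro a b c d ha hb h1 h2 hc hd h3 h4
    rw [← E]
    have := hh_nonneg
    gcongr <;> first | assumption | exact this _ | exact mul_nonneg (this _) (this _)
  have be := hh_ge1 Nat.prime_two he
  have bf := hh_ge1 Nat.prime_two hf
  have he3 : e < 3 := by
    by_contra hc
    have := hle _ _ 1 1 (by norm_num) (by positivity) (hh_two_ge (by omega)) bf le_rfl le_rfl q1 q2
    norm_num at this
  have hf3 : f < 3 := by
    by_contra hc
    have := hle _ _ 1 1 (by positivity) (by norm_num) be (hh_two_ge (by omega)) le_rfl le_rfl q1 q2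
    norm_num at this
  have s1 := sbu_prime Nat.prime_two
  have s2 := sbu_sq Nat.prime_two
  have t1 := hh_prime Nat.prime_two
  have t2 := hh_sq Nat.prime_two
  norm_num at s1 s2 t1 t2
  rw [hs'] at h
  rw [hs] at hMm
  rw [hNn] at h
  have : (e = 1 ∧ f = 1) ∨ (e = 1 ∧ f = 2) ∨ (e = 2 ∧ f = 1) ∨ (e = 2 ∧ f = 2) := by omega
  rcases this with ⟨rfl, rfl⟩ | ⟨rfl, rfl⟩ | ⟨rfl, rfl⟩ | ⟨rfl, rfl⟩
  · have := hle (3/2) (3/2) 1 1 (by norm_num) (by norm_num) (by norm_num [t1]) (by norm_num [t1]) le_rfl le_rfl q1 q2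
    norm_num at this
  · norm_num [s1, s2] at h hMm
    have a1 := hh_dvd p3 hm (by omega)
    have := hle (3/2) (5/4) 1 _ (by norm_num) (by norm_num) (by norm_num [t1]) (by norm_num [t2]) le_rfl (by norm_num) q1 a1
    norm_num at this
  · norm_num [s1, s2] at h hMm
    have a1 := hh_dvd p3 hn (by omega)
    have a2 := hh_dvd p5 hm (by omega)
    have := hle (5/4) (3/2) _ _ (by norm_num) (by norm_num) (by norm_num [t2]) (by norm_num [t1]) (by norm_num) (by norm_num) a1 a2
    norm_num at this
  · norm_num [s1, s2] at h hMm
    exact even22 (n := n) (m := m) (by omega) (by omega) (by omega) (by omega)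

theorem qpow_of_dvd {u q f g : ℕ} (hq : q.Prime) (hu : u % 2 = 1) (h : u ∣ 2^f * q^g) : ∃ b, u = q^b := by
  have hc : Nat.Coprime u (2^f) := Nat.Coprime.pow_right _ (Nat.coprime_two_right.mpr (Nat.odd_iff.mpr hu))
  obtain ⟨b, _, hb⟩ := (Nat.dvd_prime_pow hq).mp (hc.dvd_of_dvd_mul_left h)
  exact ⟨b, hb⟩

theorem hh_gt_one {p : ℕ} (hp : p.Prime) {e : ℕ} (he : 0 < e) : 1 < hh (p ^ e) := by
  have := hh_ge1 hp he
  have h0 : (0:ℚ) < p := by exact_mod_cast hp.pos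
  have : (0:ℚ) < 1 / p^2 := by positivity
  linarith

theorem eq_of_prime_pow {p q a b : ℕ} (hp : p.Prime) (hq : q.Prime) (h : p ^ a = q ^ b) (ha : 0 < a) : p = q :=
  (Nat.prime_dvd_prime_iff_eq hp hq).mp (hp.dvd_of_dvd_pow (h ▸ dvd_pow_self p ha.ne'))

theorem odd_f1 {N q g : ℕ} (hN : N % 2 = 1) (hq : q.Prime) (hq2 : q ≠ 2) (hg : 0 < g)
    (h1 : sbu N = 2 * q^g) (h2 : 3 * sbu (q^g) = 2 * N) (hE : hh N * (3/2) * hh (q^g) = 2) (hN1 : N ≠ 1) : N = 9 := by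
  have p3 : Nat.Prime 3 := by norm_num
  have hqo := pow_odd_mod (odd_of_ne_two hq hq2) g
  have h3 : 3 ∣ N := by omega
  rcases not4 hN (by omega) with h | ⟨r, e, hr, hr2, he, hre⟩
  · exact absurd h hN1
  have hr3 : 3 = r := (Nat.prime_dvd_prime_iff_eq p3 hr).mp (p3.dvd_of_dvd_pow (hre ▸ h3))
  subst hr3
  by_cases he2 : e = 2
  · rw [hre, he2]; norm_num
  exfalso
  have a1 := hh_ge p3 he he2
  have a2 := hh_gt_one hq hg
  rw [← hre] at a1
  norm_num at a1
  nlinarith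

theorem odd_f2 {N q g : ℕ} (hN : N % 2 = 1) (hq : q.Prime) (hq2 : q ≠ 2) (hg : 0 < g)
    (h1 : sbu N = 4 * q^g) (h2 : 5 * sbu (q^g) = 2 * N) (hE : hh N * (5/4) * hh (q^g) = 2) : False := by
  have p5 : Nat.Prime 5 := by norm_num
  have hqo := pow_odd_mod (odd_of_ne_two hq hq2) g
  have hq3 : 3 ≤ q := by have := hq.two_le; omega
  have hq3' : (3:ℚ) ≤ q := by exact_mod_cast hq3
  obtain ⟨e, m, he, hNm, h5m, hm, hs⟩ := sbu_split p5 (by omega) (show 5 ∣ N by omega)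
  have ev5 := two_dvd_sbu p5 (by norm_num) he
  have hhN : hh N = hh (5^e) * hh m := by rw [hNm, hh_mul p5 e hm h5m]
  have hm2 : m % 2 = 1 := by
    by_contra hc
    have : 2 ∣ N := by rw [hNm]; exact Dvd.dvd.mul_left (by omega) _
    omega
  by_cases hm1 : m = 1
  · subst hm1
    have hh1 : hh 1 = 1 := by unfold hh; rw [sbu_one]; norm_num
    rw [hh1, mul_one] at hhN
    rw [hhN] at hE
    obtain ⟨k, rfl⟩ : ∃ k, e = k + 1 := ⟨e-1, by omega⟩
    have h3 : sbu (q^g) = 2 * 5^k := by rw [hNm, pow_succ] at h2; omega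
    have h5 := hh_lt p5 (k+1)
    norm_num at h5
    have h6 : 32/25 < hh (q^g) := by
      by_contra hc
      push Not at hc
      have := hh_nonneg (5^(k+1))
      nlinarith
    rcases lemL hq hq2 p5 (by norm_num) hg h3 with rfl | rfl
    · rw [hh_prime hq] at h6
      have h7 : (q:ℚ) < 4 := by
        by_contra hc
        push Not at hc
        have : 1 / (q:ℚ) ≤ 1 / 4 := by gcongr
        linarith
      have h8 : q < 4 := by exact_mod_cast h7
      have : q = 3 := by omega
      subst this
      rw [sbu_prime hq] at h3
      have := pow_odd_mod (show 5 % 2 = 1 by norm_num) k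
      omega
    · rw [hh_sq hq] at h6
      have : 1 / (q:ℚ)^2 ≤ 1 / 3^2 := by gcongr
      norm_num at this h6
      linarith
  · rw [hs] at h1
    obtain ⟨A, hA⟩ := ev5
    have h4m : ¬ 4 ∣ sbu m := by
      rintro ⟨c, hc⟩
      rw [hA, hc] at h1
      have : 2 * (A * c) = q^g := by linarith
      omega
    rcases not4 hm2 h4m with h | ⟨p, d, hp, hp2, hd, hpd⟩
    · exact hm1 h
    obtain ⟨B, hB⟩ := two_dvd_sbu hp hp2 hd
    rw [← hpd] at hB
    have hAB : A * B = q^g := by rw [hA, hB] at h1; linarith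
    obtain ⟨x, _, hx⟩ := (Nat.dvd_prime_pow hq).mp ⟨B, hAB.symm⟩
    obtain ⟨y, _, hy⟩ := (Nat.dvd_prime_pow hq).mp (show B ∣ q^g from ⟨A, by rw [← hAB]; ring⟩)
    have hm1' : 1 < hh m := by rw [hpd]; exact hh_gt_one hp hd
    rw [hhN] at hE
    rcases lemL p5 (by norm_num) hq hq2 he (by rw [hA, hx]) with rfl | rfl
    · rw [sbu_prime p5] at hA
      have hq' : 3 = q := eq_of_prime_pow (a := 1) (b := x) (by norm_num) hq (by omega) one_pos
      subst hq'
      rw [hh_prime p5] at hE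
      norm_num at hE
      by_cases hg2 : g = 2
      · subst hg2
        rw [sbu_sq hq, hNm] at h2
        omega
      · have := hh_ge hq hg hg2
        norm_num at this
        nlinarith
    · rw [sbu_sq p5] at hA
      have hq' : 13 = q := eq_of_prime_pow (a := 1) (b := x) (by norm_num) hq (by omega) one_pos
      subst hq'
      rw [hh_sq p5] at hE
      have h13 := hh_lt hq g
      norm_num at hE h13
      have hp3 : 3 ≤ p := by have := hp.two_le; omega
      have hp3' : (3:ℚ) ≤ p := by exact_mod_cast hp3
      have hmle : hh m ≤ 4/3 := by
        rw [hpd]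
        rcases lemL hp hp2 hq hq2 hd (by rw [← hpd, hB, hy]) with rfl | rfl
        · rw [hh_prime hp]
          have : 1 / (p:ℚ) ≤ 1 / 3 := by gcongr
          linarith
        · rw [hh_sq hp]
          have : 1 / (p:ℚ)^2 ≤ 1 / 3^2 := by gcongr
          norm_num at this ⊢
          linarith
      have := hh_nonneg (13^g)
      nlinarith

theorem odd_fodd {N q g j : ℕ} (hN : N % 2 = 1) (hq : q.Prime) (hg : 0 < g) (hj : 0 < j)
    (h1 : sbu N = 2^(2*j+1) * q^g) (h2 : sbu (2^(2*j+1)) * sbu (q^g) = 2 * N)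
    (hE : hh N * hh (2^(2*j+1)) * hh (q^g) = 2) : False := by
  have p3 : Nat.Prime 3 := by norm_num
  have p5 : Nat.Prime 5 := by norm_num
  have h3 : 3 ∣ sbu (2^(2*j+1)) := by
    rw [sbu_two_odd]
    have : (2^(j+1)-1) * (2^(j+1)+1) = 4^(j+1) - 1^(j+1) := by
      rw [show 4 = 2^2 by norm_num, ← pow_mul, mul_comm 2, pow_mul, one_pow, mul_comm, ← one_pow 2, ← Nat.sq_sub_sq]
      simp
    rw [this]
    exact Nat.sub_dvd_pow_sub_pow 4 1 (j+1)
  have h3N : 3 ∣ N := by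
    have : 3 ∣ 2 * N := h2 ▸ h3.mul_right _
    omega
  obtain ⟨e, m, he, hNm, h3m, hm, hs⟩ := sbu_split p3 (by omega) h3N
  have b1 := hh_ge3 Nat.prime_two (e := 2*j+1) (by omega)
  have b2 := one_le_hh hm
  have b3 := hh_gt_one hq hg
  norm_num at b1
  rw [hNm, hh_mul p3 e hm h3m] at hE
  have hle : ∀ a d : ℚ, 0 ≤ a → 1 ≤ d → a ≤ hh (3^e) → d ≤ hh (q^g) → a * 1 * (7/4) * d ≤ 2 := by
    intro a d ha hd h1 h2
    rw [← hE]
    have := hh_nonneg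
    gcongr <;> first | assumption | exact this _ | exact mul_nonneg (mul_nonneg (this _) (this _)) (this _) | exact mul_nonneg (this _) (this _)
  by_cases he2 : e = 2
  · subst he2
    rw [hs, sbu_sq p3] at h1
    have h5 : 5 ∣ 2^(2*j+1) * q^g := by rw [← h1]; exact Dvd.dvd.mul_right (by norm_num) _
    have h5q : 5 ∣ q^g := by
      rcases (p5.dvd_mul).mp h5 with h | h
      · have := p5.dvd_of_dvd_pow h
        omega
      · exact h
    have hq5 : 5 = q := (Nat.prime_dvd_prime_iff_eq p5 hq).mp (p5.dvd_of_dvd_pow h5q)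
    subst hq5
    have := hle (10/9) (26/25) (by norm_num) (by norm_num) (by rw [hh_sq p3]; norm_num) (by have := hh_ge1 hq hg; norm_num at this; exact this)
    norm_num at this
  · have := hle _ 1 (by positivity) le_rfl (hh_ge p3 he he2) b3.le
    norm_num at this

theorem sq_mod8 {x : ℕ} (h : x % 2 = 1) : x^2 % 8 = 1 := by
  have : x % 8 = 1 ∨ x % 8 = 3 ∨ x % 8 = 5 ∨ x % 8 = 7 := by omega
  rcases this with h | h | h | h <;> simp [Nat.pow_mod, h]

theorem bound_aux {T x : ℕ} (hT : 2 ≤ T) (hx : 0 < x) {H : ℚ} (hH : 1 + 1 / (x:ℚ) ≤ H)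
    (h : H * (((T:ℚ)-1)*(2*T+1)/T^2) ≤ 2) : (T-1)*(2*T+1) ≤ x*(T+1) := by
  obtain ⟨S, rfl⟩ : ∃ S, T = S + 1 := ⟨T-1, by omega⟩
  have hx' : (0:ℚ) < x := by exact_mod_cast hx
  push_cast at h
  have hS : (0:ℚ) ≤ S := by positivity
  have h3 : (1 + 1 / (x:ℚ)) * ((((S:ℚ)+1)-1)*(2*(S+1)+1)/(S+1)^2) ≤ 2 := by
    refine le_trans ?_ h
    gcongr
    simp; positivity
  rw [show (1 + 1 / (x:ℚ)) = (x+1)/x by field_simp, div_mul_div_comm, div_le_iff₀ (by positivity)] at h3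
  have h4 : ((S:ℚ))*(2*(S+1)+1) ≤ x*((S+1)+1) := by nlinarith
  simp only [Nat.add_sub_cancel]
  exact_mod_cast h4

set_option maxHeartbeats 4000000 in
theorem odd_feven {N q g k : ℕ} (hN : N % 2 = 1) (hq : q.Prime) (hg : 0 < g) (hk : 2 ≤ k)
    (h1 : sbu N = 2^(2*k) * q^g) (h2 : sbu (2^(2*k)) * sbu (q^g) = 2 * N)
    (hE : hh N * hh (2^(2*k)) * hh (q^g) = 2) : False := by
  have p3 : Nat.Prime 3 := by norm_num
  have hN0 : N ≠ 0 := by omega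
  obtain ⟨T, hT⟩ : ∃ T, T = 2^k := ⟨_, rfl⟩
  have hT4 : 4 ≤ T := by
    rw [hT]; exact le_trans (by norm_num) (Nat.pow_le_pow_right (n := 2) (by norm_num) hk)
  have hTq : (4:ℚ) ≤ T := by exact_mod_cast hT4
  have hs2 : sbu (2^(2*k)) = (T-1)*(2*T+1) := by
    rw [sbu_two_even k (by omega), hT, pow_succ, mul_comm (2^k) 2]
  have hh2 : hh (2^(2*k)) = ((T:ℚ)-1)*(2*T+1)/T^2 := by
    unfold hh
    rw [hs2, mul_comm 2 k, pow_mul, ← hT]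
    push_cast [Nat.cast_sub (show 1 ≤ T by omega)]
    rfl
  have hq1 := hh_gt_one hq hg
  have hle : hh N * (((T:ℚ)-1)*(2*T+1)/T^2) ≤ 2 := by
    refine le_trans ?_ hE.le
    rw [hh2]
    apply le_mul_of_one_le_right _ hq1.le
    rw [← hh2]
    exact mul_nonneg (hh_nonneg _) (hh_nonneg _)
  have hpos : 0 ≤ (((T:ℚ)-1)*(2*T+1)/T^2) := by rw [← hh2]; exact hh_nonneg _
  have hdN : ∀ r, r.Prime → r ∣ (T-1)*(2*T+1) → r ∣ N := by
    intro r hr hd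
    have h3 : r ∣ 2 * N := by rw [← h2, hs2]; exact hd.mul_right _
    rcases (hr.dvd_mul).mp h3 with h | h
    · exfalso
      have := (Nat.prime_dvd_prime_iff_eq hr Nat.prime_two).mp h
      subst this
      have := sbu_two_mod (2*k)
      rw [hs2] at this
      omega
    · exact h
  have bnd : ∀ r e m, r.Prime → 0 < e → m ≠ 0 → ¬ r ∣ m → N = r^e * m →
      ((e ≠ 2 → (T-1)*(2*T+1) ≤ r*(T+1)) ∧ (T-1)*(2*T+1) ≤ r^2*(T+1)) := by
    intro r e m hr he hm hrm hNm
    have hle' : hh (r^e) * (((T:ℚ)-1)*(2*T+1)/T^2) ≤ 2 := by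
      refine le_trans ?_ hle
      apply mul_le_mul_of_nonneg_right _ hpos
      rw [hNm, hh_mul hr e hm hrm]
      exact le_mul_of_one_le_right (hh_nonneg _) (one_le_hh hm)
    refine ⟨fun h => bound_aux (by omega) hr.pos (hh_ge hr he h) hle',
      bound_aux (by omega) (pow_pos hr.pos 2) (by push_cast; exact hh_ge1 hr he) hle'⟩
  by_cases hk2 : k = 2
  · subst hk2
    norm_num at hT
    subst hT
    have h27 : 27 ∣ N := by
      have : 27 * sbu (q^g) = 2 * N := by rw [← h2, hs2]
      omega
    obtain ⟨e, m, he, hNm, h3m, hm, hs⟩ := sbu_split p3 hN0 (by omega)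
    have hb := bnd 3 e m p3 he hm h3m hNm
    by_cases he2 : e = 2
    · rw [he2] at hNm
      omega
    · have := hb.1 he2
      omega
  have hT8 : 8 ≤ T := by
    rw [hT]; exact le_trans (by norm_num) (Nat.pow_le_pow_right (n := 2) (by norm_num) (show 3 ≤ k by omega))
  obtain ⟨S, hS⟩ : ∃ S, T = S + 1 := ⟨T-1, by omega⟩
  have hTS : T - 1 = S := by omega
  rw [hTS] at bnd hdN
  -- T - 1 is prime and occurs exactly with exponent two
  have hS1 : S ≠ 1 := by omega
  have hpp := Nat.minFac_prime hS1
  obtain ⟨e, m, he, hNm, hpm, hm, hs⟩ := sbu_split hpp hN0 (hdN _ hpp ((Nat.minFac_dvd S).mul_right _))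
  have hb := bnd _ e m hpp he hm hpm hNm
  have hpS : S.minFac ≤ S := Nat.minFac_le (by omega)
  have he2 : e = 2 := by
    by_contra hc
    have := hb.1 hc
    nlinarith
  have hSp : S.Prime := by
    by_contra hc
    have h3 := Nat.minFac_sq_le_self (by omega) hc
    have := hb.2
    nlinarith
  have hmf : S.minFac = S := hSp.minFac_eq
  rw [hmf, he2] at hNm hs
  rw [hmf] at hpm
  clear hb hpS hpp he he2 hmf
  have hTe : T % 8 = 0 := by
    obtain ⟨l, rfl⟩ : ∃ l, k = l + 3 := ⟨k-3, by omega⟩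
    rw [hT, pow_add]; omega
  obtain ⟨u, hu⟩ : ∃ u, S^2 + 1 = 2 * u := by
    have := sq_mod4 (x := S) (by omega)
    exact ⟨(S^2+1)/2, by omega⟩
  have huo : u % 2 = 1 := by
    have := sq_mod4 (x := S) (by omega)
    omega
  have hud : u ∣ 2^(2*k) * q^g := by
    rw [← h1, hs, sbu_sq hSp, hu]
    exact ((dvd_mul_left u 2).mul_right _)
  obtain ⟨b, hub⟩ := qpow_of_dvd hq huo hud
  have hu1 : 1 < u := by nlinarith
  have hqu : q ∣ u := by rw [hub]; exact dvd_pow_self q (by rintro rfl; simp at hub; omega)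
  have hq3 : q ≠ 3 := by
    rintro rfl
    have h3 : 3 ∣ S^2 + 1 := by rw [hu]; exact hqu.mul_left _
    have : S % 3 = 0 ∨ S % 3 = 1 ∨ S % 3 = 2 := by omega
    have h4 : (S^2+1) % 3 = 0 := Nat.mod_eq_zero_of_dvd h3
    rcases this with h | h | h <;> simp [Nat.add_mod, Nat.pow_mod, h] at h4
  -- k is odd
  obtain ⟨i, hi⟩ : ∃ i, k = 2*i+1 := by
    rcases Nat.even_or_odd' k with ⟨i, hi | hi⟩
    · exfalso
      have h4 : T % 3 = 1 := by rw [hT, hi, pow_mul, Nat.pow_mod]; simp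
      have h5 : 3 ∣ S := by omega
      have := (Nat.prime_dvd_prime_iff_eq p3 hSp).mp h5
      omega
    · exact ⟨i, hi⟩
  have hT3 : T % 3 = 2 := by
    rw [hT, hi, pow_succ, pow_mul, Nat.mul_mod, Nat.pow_mod]; simp
  have hTsq : 2 * T = (2^(i+1))^2 := by
    rw [hT, hi]; ring
  -- the factor two T plus one is prime
  have hP : (2*T+1).Prime := by
    by_contra hc
    have hr := Nat.minFac_prime (show 2*T+1 ≠ 1 by omega)
    obtain ⟨r, hrdef⟩ : ∃ r, r = (2*T+1).minFac := ⟨_, rfl⟩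
    rw [← hrdef] at hr
    have hrd : r ∣ 2*T+1 := hrdef ▸ Nat.minFac_dvd _
    have hr2 : r^2 ≤ 2*T+1 := hrdef ▸ Nat.minFac_sq_le_self (by omega) hc
    have hro : r % 2 = 1 := odd_of_ne_two hr (by rintro rfl; omega)
    obtain ⟨e, m, he, hNm, hpm, hm, hs⟩ := sbu_split hr hN0 (hdN _ hr (hrd.mul_left _))
    have hb := bnd _ e m hr he hm hpm hNm
    have hr3 : 3 ≤ r := by have := hr.two_le; omega
    have h8 := sq_mod8 hro
    have h9 : 2*T-3 < r^2 := by
      by_contra hcc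
      have h10 : r^2 + 3 ≤ 2*T := by omega
      have h11 := hb.2
      obtain ⟨R, hR⟩ : ∃ R, R = r^2 := ⟨_, rfl⟩
      rw [← hR] at h10 h11
      have h12 := Nat.mul_le_mul_right (T+1) h10
      clear * - h11 h12 hS
      subst hS
      nlinarith
    have h10 : r^2 = 2*T+1 := by omega
    rw [hTsq] at h10
    have h11 : 2^(i+1) < r := by
      by_contra hcc
      have : r^2 ≤ (2^(i+1))^2 := Nat.pow_le_pow_left (by omega) 2
      omega
    have h12 : 1 ≤ 2^(i+1) := Nat.one_le_two_pow
    clear * - h10 h11 h12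
    nlinarith
  have hPN := hdN _ hP (dvd_mul_left _ _)
  have hPS : 2*T+1 ≠ S := by omega
  have hPm : 2*T+1 ∣ m := by
    rw [hNm] at hPN
    rcases (hP.dvd_mul).mp hPN with h | h
    · exact absurd ((Nat.prime_dvd_prime_iff_eq hP hSp).mp (hP.dvd_of_dvd_pow h)) hPS
    · exact h
  obtain ⟨e, m', he, hmm, hPm', hm', hs'⟩ := sbu_split hP hm hPm
  have hPdvd : sbu ((2*T+1)^e) ∣ 2^(2*k) * q^g := by
    rw [← h1, hs, hs']
    exact (dvd_mul_right _ _).mul_left _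
  by_cases he2 : e = 2
  · rw [he2, sbu_sq hP] at hPdvd
    have hmod := sq_mod4 (x := 2*T+1) (by omega)
    obtain ⟨v, hv⟩ : ∃ v, (2*T+1)^2 + 1 = 2 * v := ⟨((2*T+1)^2+1)/2, by omega⟩
    obtain ⟨b', hvb⟩ := qpow_of_dvd (u := v) hq (by omega) ((Dvd.intro_left 2 hv.symm).trans hPdvd)
    have huv : v = 4 * u + (6*T - 3) := by
      have : v + 3 = 4 * u + 6 * T := by rw [hS] at hv ⊢; nlinarith
      omega
    have hbb : b ≤ b' := by
      apply (Nat.pow_le_pow_iff_right hq.one_lt).mp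
      rw [← hub, ← hvb]; omega
    have hd : u ∣ v := by rw [hub, hvb]; exact pow_dvd_pow _ hbb
    rw [huv] at hd
    have hd' : u ∣ 6*T-3 := (Nat.dvd_add_right (dvd_mul_left u 4)).mp hd
    have hle6 := Nat.le_of_dvd (by omega) hd'
    have hT16 : T < 16 := by
      by_contra hc
      have : u + 3 ≤ 6 * T := by omega
      rw [hS] at this hc
      nlinarith
    have : T = 8 := by omega
    have hS7 : S = 7 := by omega
    rw [hS7] at hu
    rw [this] at hd'
    have : u = 25 := by omega
    subst this
    revert hd'
    decide
  · by_cases he5 : 5 ≤ e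
    · have b1 := hh_ge3 hP (Or.inr he5)
      have b2 := hh_sq hSp
      have b3 := one_le_hh hm'
      have hSq : (T:ℚ) = S + 1 := by rw [hS]; push_cast; ring
      have hS7 : (7:ℚ) ≤ S := by linarith [show (8:ℚ) ≤ T by exact_mod_cast hT8]
      rw [hNm, hmm, hh_mul hSp 2 (hmm ▸ hm) (hmm ▸ hpm), hh_mul hP e hm' hPm', b2] at hle
      have hle2 : (1 + 1 / (S:ℚ)^2) * ((1 + 1 / ((2*T+1:ℕ):ℚ) + 1 / ((2*T+1:ℕ):ℚ)^2) * 1) * (((T:ℚ)-1)*(2*T+1)/T^2) ≤ 2 := by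
        refine le_trans ?_ hle
        apply mul_le_mul_of_nonneg_right _ hpos
        apply mul_le_mul_of_nonneg_left _ (by positivity)
        apply mul_le_mul b1 b3 (by norm_num) (hh_nonneg _)
      push_cast at hle2
      rw [hSq] at hle2
      have hS0 : (0:ℚ) < S := by linarith
      rw [show (1 + 1 / (S:ℚ)^2) * ((1 + 1 / (2*((S:ℚ)+1)+1) + 1 / (2*((S:ℚ)+1)+1)^2) * 1) * ((((S:ℚ)+1)-1)*(2*(S+1)+1)/(S+1)^2)
        = ((S^2+1) * ((2*S+3)^2+(2*S+3)+1)) / (S * (2*S+3) * (S+1)^2) by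
          have : (2*((S:ℚ)+1)+1) = 2*S+3 := by ring
          rw [this]
          have : (2*(S:ℚ)+3) ≠ 0 := by positivity
          field_simp
          ring] at hle2
      rw [div_le_iff₀ (by positivity)] at hle2
      nlinarith
    · have h3 : 2*T+1+1 ∣ sbu ((2*T+1)^e) := by
        have : e = 1 ∨ e = 3 ∨ e = 4 := by omega
        rcases this with rfl | rfl | rfl
        · rw [sbu_prime hP]
        · rw [sbu_odd hP 1, Finset.sum_range_succ, Finset.sum_range_one, pow_zero, pow_one, add_comm 1]
          exact dvd_mul_right _ _
        · rw [sbu_even hP 2 (by norm_num), Finset.sum_range_succ, Finset.sum_range_one, pow_zero, pow_one, add_comm 1]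
          exact dvd_mul_right _ _
      have h4 : 3 ∣ 2^(2*k) * q^g := Dvd.dvd.trans (by omega) (h3.trans hPdvd)
      rcases (p3.dvd_mul).mp h4 with h | h
      · have := p3.dvd_of_dvd_pow h
        omega
      · exact hq3 ((Nat.prime_dvd_prime_iff_eq p3 hq).mp (p3.dvd_of_dvd_pow h)).symm

theorem caseOdd {N : ℕ} (hN : N % 2 = 1) (hN1 : N ≠ 1) (h : sbu (sbu N) = 2 * N) : N = 9 := by
  have hN0 : N ≠ 0 := by omega
  have hM0 := sbu_ne_zero hN0
  have hM2 : 2 ∣ sbu N := by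
    obtain ⟨p, hp, hpN⟩ := Nat.exists_prime_and_dvd hN1
    obtain ⟨e, m, he, -, -, -, hs⟩ := sbu_split hp hN0 hpN
    rw [hs]; exact (two_dvd_sbu hp (by rintro rfl; omega) he).mul_right _
  have hE := hh_eq hN0 h
  obtain ⟨f, m, hf, hMm, hm2, hm, hs⟩ := sbu_split Nat.prime_two hM0 hM2
  rw [hs] at h
  rw [hMm, hh_mul Nat.prime_two f hm hm2, ← mul_assoc] at hE
  have ho := sbu_two_mod f
  have h4 : ¬ 4 ∣ sbu m := by
    intro hd
    have : 4 ∣ 2 * N := h ▸ hd.mul_left _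
    omega
  rcases not4 (by omega) h4 with hm1 | ⟨q, g, hq, hq2, hg, rfl⟩
  · rw [hm1, sbu_one] at h
    omega
  rcases exp_cases hf with ⟨j, rfl⟩ | ⟨j, hj, rfl⟩
  · rcases Nat.eq_zero_or_pos j with rfl | hj
    · rw [mul_zero, zero_add, sbu_prime Nat.prime_two] at h
      rw [mul_zero, zero_add, hh_prime Nat.prime_two] at hE
      rw [mul_zero, zero_add, pow_one] at hMm
      exact odd_f1 hN hq hq2 hg hMm h (by
        have e : (1 + 1/((2:ℕ):ℚ)) = 3/2 := by norm_num
        rwa [e] at hE) hN1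
    · exact (odd_fodd hN hq hg hj hMm h hE).elim
  · rcases (show j = 1 ∨ 2 ≤ j by omega) with rfl | hj2
    · rw [mul_one, sbu_sq Nat.prime_two] at h
      rw [mul_one, hh_sq Nat.prime_two] at hE
      rw [mul_one] at hMm
      exact (odd_f2 hN hq hq2 hg hMm h (by
        have e : (1 + 1/((2:ℕ):ℚ)^2) = 5/4 := by norm_num
        rwa [e] at hE)).elim
    · exact (odd_feven hN hq hg hj2 hMm h hE).elim

theorem stmt19 (N : ℕ) (hN : 0 < N) :
    sbu (sbu N) = 2 * N ↔ N = 2 ∨ N = 9 := by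
  constructor
  · intro h
    have hN1 : N ≠ 1 := by
      rintro rfl
      rw [sbu_one, sbu_one] at h
      omega
    rcases Nat.mod_two_eq_zero_or_one N with h0 | h1
    · left
      rcases Nat.mod_two_eq_zero_or_one (sbu N) with h2 | h2
      · exact (caseEven hN.ne' (by omega) (by omega) h).elim
      · exact caseModd hN.ne' hN1 h2 h
    · right; exact caseOdd h1 hN1 h
  · have e2 : sbu 2 = 3 := by have := sbu_prime Nat.prime_two; simpa using this
    have e3 : sbu 3 = 4 := by have := sbu_prime Nat.prime_three; simpa using this
    have e5 : sbu 5 = 6 := by have := sbu_prime Nat.prime_five; simpa using this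
    have e9 : sbu 9 = 10 := by have := sbu_sq Nat.prime_three; simpa using this
    have e10 : sbu 10 = 18 := by
      have := sbu_mul_pow Nat.prime_two 1 (m := 5) (by norm_num) (by norm_num)
      norm_num [e2, e5] at this; exact this
    rintro (rfl | rfl)
    · rw [e2, e3]
    · rw [e9, e10]
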